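/- Let n ≥ 2 and let G be a strongly connected directed simple graph on Fin n with distinguished vertex 0 that is minimally strongly connected: for every pair (a,b) with E a b, the relation E' defined by E' x y ↔ (E x y ∧ ¬(x = a ∧ y = b)) is not strongly connected. Then there exists A ∈ Θ_G such that B_G(A) (with distinguished vertex 0) has full column rank (n−1)·(n−2). -/

import Mathlib

open Matrix

attribute [local instance] Classical.propDecidable

variable {V : Type*}

/-- The parameter space `Θ_G` of a directed simple graph given by the edge
relation `E` (where `E j i` means there is an edge `j → i`): matrices whose
off-diagonal entry `(i,j)` vanishes unless `j → i` is an edge. -/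
def Theta (E : V → V → Prop) : Set (Matrix V V ℂ) :=
  {A | ∀ i j, i ≠ j → ¬ E j i → A i j = 0}

/-- The coefficient matrix `B_G(A)`: rows indexed by the non-edges
`(k,l)` (the zero positions of a generic element of `Θ_G`), columns indexed
by pairs `(i,j)` with `i ≠ j` avoiding the distinguished vertex `r`. -/
noncomputable def Bmat (E : V → V → Prop) (r : V) (A : Matrix V V ℂ) :
    Matrix {p : V × V // p.1 ≠ p.2 ∧ ¬ E p.2 p.1}
      {p : V × V // p.1 ≠ p.2 ∧ p.1 ≠ r ∧ p.2 ≠ r} ℂ :=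
  fun kl ij =>
    if ij.1.1 = kl.1.1 ∧ ij.1.2 = kl.1.2 then A kl.1.1 kl.1.1 - A kl.1.2 kl.1.2
    else if ij.1.1 = kl.1.1 then -A ij.1.2 kl.1.2
    else if ij.1.2 = kl.1.2 then A kl.1.1 ij.1.1
    else 0

/-- `B_G(A)` has full column rank `(|V|-1)(|V|-2)` for some `A ∈ Θ_G`. -/
def HasFullB [Fintype V] (E : V → V → Prop) (r : V) : Prop :=
  ∃ A ∈ Theta E, (Bmat E r A).rank = (Fintype.card V - 1) * (Fintype.card V - 2)


section Perturbation

variable {M N : Type*} [AddCommGroup M] [Module ℝ M] [FiniteDimensional ℝ M]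
  [AddCommGroup N] [Module ℝ N]

/-- Injectivity of a linear map on a finite-dimensional space survives some positive multiple of
any perturbation. -/
lemma LinearMap.exists_pos_injective_add_smul (f g : M →ₗ[ℝ] N) (hf : Function.Injective f) :
    ∃ t : ℝ, 0 < t ∧ Function.Injective (f + t • g) := by
  obtain ⟨h, hh⟩ := f.exists_leftInverse_of_injective (LinearMap.ker_eq_bot.2 hf)
  have hfin : Set.Finite {μ : ℝ | Module.End.HasEigenvalue (h ∘ₗ g) μ} :=
    Module.End.finite_hasEigenvalue _
  obtain ⟨μ, hμ, hev⟩ := (Set.Iio_infinite (0 : ℝ)).exists_notMem_finite hfin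
  have hμ0 : μ < 0 := hμ
  refine ⟨-μ⁻¹, by simpa using hμ0, ?_⟩
  rw [← LinearMap.ker_eq_bot, LinearMap.ker_eq_bot']
  intro x hx
  by_contra hx0
  refine hev (Module.End.hasEigenvalue_of_hasEigenvector (x := x)
    ⟨Module.End.mem_eigenspace_iff.2 ?_, hx0⟩)
  have h1 : h (f x) = x := LinearMap.congr_fun hh x
  have h2 : h ((f + (-μ⁻¹) • g) x) = 0 := by rw [hx, map_zero]
  simp only [LinearMap.add_apply, LinearMap.smul_apply, map_add, map_smul, h1] at h2
  have h3 : x = μ⁻¹ • h (g x) := by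
    rw [neg_smul, ← sub_eq_add_neg, sub_eq_zero] at h2
    exact h2
  rw [LinearMap.comp_apply]
  nth_rw 2 [h3]
  rw [smul_inv_smul₀ hμ0.ne]

end Perturbation

section MaximumPrinciple

variable [Fintype V]

/-- Minimum principle for a matrix with nonnegative entries and row sums below `γ`. -/
lemma nonneg_of_sum_mul_le {A : Matrix V V ℝ} {γ : ℝ} (hA : ∀ i j, 0 ≤ A i j)
    (hγ : ∀ i, ∑ j, A i j < γ) {y : V → ℝ} (hy : ∀ i, ∑ j, A i j * y j ≤ γ * y i) (i : V) :
    0 ≤ y i := by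
  have : Nonempty V := ⟨i⟩
  obtain ⟨m, hm⟩ := Finite.exists_min y
  refine le_trans ?_ (hm i)
  by_contra! hneg
  have h1 : (∑ j, A m j) * y m ≤ ∑ j, A m j * y j := by
    rw [Finset.sum_mul]
    exact Finset.sum_le_sum fun j _ => mul_le_mul_of_nonneg_left (hm j) (hA m j)
  nlinarith [hy m, hγ m]

/-- If `y` is a `γ`-eigenvector of a nonnegative matrix with row sums below `γ` except in one
coordinate `b`, and `y` vanishes at some `r` reachable from `b`, then `y` vanishes. -/
lemma eq_zero_of_reachable {A : Matrix V V ℝ} {γ : ℝ} (hA : ∀ i j, 0 ≤ A i j)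
    (hγ : ∀ i, ∑ j, A i j < γ) {b r : V}
    (hbr : Relation.ReflTransGen (fun x y => A y x ≠ 0) b r) {y : V → ℝ} (hr : y r = 0)
    (hy : ∀ i, i ≠ b → ∑ j, A i j * y j = γ * y i) (i : V) : y i = 0 := by
  suffices key : ∀ y : V → ℝ, y r = 0 → (∀ i, i ≠ b → ∑ j, A i j * y j = γ * y i) →
      ∑ j, A b j * y j ≤ γ * y b → ∀ i, y i = 0 by
    rcases le_total (∑ j, A b j * y j) (γ * y b) with h | h
    · exact key y hr hy h i
    · have := key (fun j => -y j) (by simp [hr])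
        (fun i hi => by simp [Finset.sum_neg_distrib, hy i hi])
        (by simpa [Finset.sum_neg_distrib] using h) i
      simpa using this
  clear! y i
  intro y hr hy hb
  have hle : ∀ i, ∑ j, A i j * y j ≤ γ * y i := fun i => by
    by_cases hi : i = b
    · exact hi ▸ hb
    · exact (hy i hi).le
  have hnn := nonneg_of_sum_mul_le hA hγ hle
  have hyb : y b = 0 := by
    refine Relation.ReflTransGen.head_induction_on (motive := fun u _ => y u = 0) hbr hr ?_
    intro u w huw _ hw
    have h1 : A w u * y u ≤ ∑ j, A w j * y j :=
      Finset.single_le_sum (f := fun j => A w j * y j)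
        (fun j _ => mul_nonneg (hA w j) (hnn j)) (Finset.mem_univ u)
    have h2 := hle w
    rw [hw, mul_zero] at h2
    have h3 : 0 < A w u := lt_of_le_of_ne (hA w u) (Ne.symm huw)
    nlinarith [hnn u]
  have hneg := nonneg_of_sum_mul_le (y := fun j => -y j) hA hγ fun i => by
    simp only [mul_neg, Finset.sum_neg_distrib, neg_le_neg_iff]
    by_cases hi : i = b
    · subst hi
      rw [hyb, mul_zero]
      exact Finset.sum_nonneg fun j _ => mul_nonneg (hA i j) (hnn j)
    · exact (hy i hi).ge
  intro i
  linarith [hnn i, hneg i]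

end MaximumPrinciple

section Witness

variable [Fintype V]

/-- A nonnegative real matrix supported on `S × S`, all of whose vertices are reachable from `r`
in the digraph of its nonzero entries, such that only `X = 0` among the matrices supported off the
diagonal of `(S \ {r}) × (S \ {r})` has a commutator with `A` vanishing at every off-diagonal zero
of `A`. -/
structure IsCommutatorWitness (r : V) (S : Set V) (A : Matrix V V ℝ) : Prop where
  root_mem : r ∈ S
  nonneg : ∀ i j, 0 ≤ A i j
  mem_of_ne_zero : ∀ i j, A i j ≠ 0 → i ∈ S ∧ j ∈ S
  reachable : ∀ u ∈ S, Relation.ReflTransGen (fun x y => A y x ≠ 0) r u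
  eq_zero : ∀ X : Matrix V V ℝ,
    (∀ i j, X i j ≠ 0 → i ∈ S ∧ j ∈ S ∧ i ≠ j ∧ i ≠ r ∧ j ≠ r) →
    (∀ k l, k ≠ l → A k l = 0 → (A * X - X * A) k l = 0) → X = 0

lemma IsCommutatorWitness.singleton (r : V) :
    IsCommutatorWitness r {r} (Matrix.single r r 1) where
  root_mem := rfl
  nonneg i j := by rw [Matrix.single_apply]; split_ifs <;> norm_num
  mem_of_ne_zero i j h := by
    rw [Matrix.single_apply] at h
    split_ifs at h with h'
    · exact ⟨h'.1.symm, h'.2.symm⟩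
    · exact absurd rfl h
  reachable u hu := by rw [Set.mem_singleton_iff.1 hu]
  eq_zero X hX _ := by
    ext i j
    by_contra h
    obtain ⟨hi, -, -, hr, -⟩ := hX i j h
    exact hr hi

/-- The matrix `A` with row `v` replaced by one having `γ` on the diagonal and `1` in column `a`. -/
noncomputable def attachVertex (A : Matrix V V ℝ) (a v : V) (γ : ℝ) : Matrix V V ℝ :=
  fun i j => if i = v then if j = v then γ else if j = a then 1 else 0 else A i j

variable {r : V} {S : Set V} {A : Matrix V V ℝ} {a b v : V} {γ : ℝ}

lemma attachVertex_ne_zero_iff (hA : IsCommutatorWitness r S A) (ha : a ∈ S) (hv : v ∉ S)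
    (hγ : 0 < γ) (i j : V) :
    attachVertex A a v γ i j ≠ 0 ↔ A i j ≠ 0 ∨ (i = v ∧ j = v) ∨ (i = v ∧ j = a) := by
  have hrow : ∀ j, A v j = 0 := fun j => by
    by_contra h
    exact hv (hA.mem_of_ne_zero v j h).1
  have hav : a ≠ v := fun h => hv (h ▸ ha)
  unfold attachVertex
  by_cases hi : i = v
  · subst hi
    by_cases hj : j = i
    · simp [hj, hγ.ne']
    · by_cases hja : j = a <;> simp [hj, hja, hav, hrow]
  · simp [hi]

/-- Attaching a vertex `v` by a single edge `a → v` keeps the commutator condition, even when the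
equation at one position `(b, v)` is dropped. -/
lemma IsCommutatorWitness.attachVertex_eq_zero (hA : IsCommutatorWitness r S A)
    (ha : a ∈ S) (hv : v ∉ S)
    (hbr : Relation.ReflTransGen (fun x y => A y x ≠ 0) b r)
    (hrow : ∀ i, ∑ j, A i j < γ) (hcol : ∀ j, ∑ i, A i j < γ) {X : Matrix V V ℝ}
    (hX : ∀ i j, X i j ≠ 0 → i ∈ insert v S ∧ j ∈ insert v S ∧ i ≠ j ∧ i ≠ r ∧ j ≠ r)
    (hcomm : ∀ k l, k ≠ l → ¬ (k = b ∧ l = v) → attachVertex A a v γ k l = 0 →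
      (attachVertex A a v γ * X - X * attachVertex A a v γ) k l = 0) : X = 0 := by
  have hAv : ∀ j, A v j = 0 := fun j => by
    by_contra h
    exact hv (hA.mem_of_ne_zero v j h).1
  have hAv' : ∀ j, A j v = 0 := fun j => by
    by_contra h
    exact hv (hA.mem_of_ne_zero j v h).2
  have hav : a ≠ v := fun h => hv (h ▸ ha)
  have hdiag : ∀ i, X i i = 0 := fun i => by
    by_contra h
    exact (hX i i h).2.2.1 rfl
  have hXr : ∀ i, X i r = 0 := fun i => by
    by_contra h
    exact (hX i r h).2.2.2.2 rfl
  have hXr' : ∀ i, X r i = 0 := fun i => by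
    by_contra h
    exact (hX r i h).2.2.2.1 rfl
  have hmul : ∀ i l, i ≠ v → (attachVertex A a v γ * X) i l = ∑ j, A i j * X j l := by
    intro i l hi
    simp [Matrix.mul_apply, attachVertex, hi]
  have hmulv : ∀ l, (attachVertex A a v γ * X) v l = γ * X v l + X a l := by
    intro l
    have : ∀ j, attachVertex A a v γ v j * X j l =
        (if j = v then γ * X v l else 0) + (if j = a then X a l else 0) := by
      intro j
      by_cases hj : j = v
      · subst hj
        simp [attachVertex, hav.symm]
      · by_cases hja : j = a
        · subst hja
          simp [attachVertex, hj]
        · simp [attachVertex, hj, hja]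
    simp [Matrix.mul_apply, this, Finset.sum_add_distrib]
  have hmul' : ∀ k l, (X * attachVertex A a v γ) k l =
      (∑ j, X k j * A j l) + X k v * attachVertex A a v γ v l := by
    intro k l
    have : ∀ j, X k j * attachVertex A a v γ j l =
        X k j * A j l + (if j = v then X k v * attachVertex A a v γ v l else 0) := by
      intro j
      by_cases hj : j = v
      · subst hj
        simp [hAv]
      · simp [attachVertex, hj]
    rw [Matrix.mul_apply, Finset.sum_congr rfl fun j _ => this j, Finset.sum_add_distrib]
    simp
  have hMvv : attachVertex A a v γ v v = γ := by simp [attachVertex]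
  have hMv : ∀ l, l ≠ v → l ≠ a → attachVertex A a v γ v l = 0 := fun l h1 h2 => by
    simp [attachVertex, h1, h2]
  have hM : ∀ k l, k ≠ v → attachVertex A a v γ k l = A k l := fun k l h => by
    simp [attachVertex, h]
  have hcolv : ∀ i, X i v = 0 := by
    refine eq_zero_of_reachable hA.nonneg hrow hbr (hXr' v) fun i hi => ?_
    by_cases hiv : i = v
    · subst hiv
      simp [hAv, hdiag]
    · have := hcomm i v hiv (fun h => hi h.1) (by rw [hM i v hiv, hAv'])
      rw [Matrix.sub_apply, hmul i v hiv, hmul', hMvv] at this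
      simp only [hAv', mul_zero, Finset.sum_const_zero, zero_add] at this
      linarith
  have hsub : ∀ i j, i ≠ v → X i j = 0 := by
    have h0 := hA.eq_zero (Matrix.of fun i j => if i = v then 0 else X i j) (fun i j hij => by
      by_cases hi : i = v
      · simp [hi] at hij
      · simp only [Matrix.of_apply, hi, if_false] at hij
        obtain ⟨h1, h2, h3⟩ := hX i j hij
        refine ⟨h1.resolve_left hi, h2.resolve_left ?_, h3⟩
        rintro rfl
        exact hij (hcolv i)) (fun k l hkl hkl0 => by
      have hl : (A * Matrix.of fun i j => if i = v then 0 else X i j) k l = ∑ j, A k j * X j l := by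
        rw [Matrix.mul_apply]
        refine Finset.sum_congr rfl fun j _ => ?_
        by_cases hj : j = v
        · simp [hj, hAv']
        · simp [hj]
      rw [Matrix.sub_apply, hl, Matrix.mul_apply]
      by_cases hk : k = v
      · subst hk
        simp [hAv]
      by_cases hlv : l = v
      · subst hlv
        simp [hAv', hcolv]
      · have := hcomm k l hkl (fun h => hlv h.2) (by rw [hM k l hk, hkl0])
        rw [Matrix.sub_apply, hmul k l hk, hmul', hcolv k, zero_mul, add_zero] at this
        simpa [hk] using this)
    intro i j hi
    have := congrFun (congrFun h0 i) j
    simpa [hi] using this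
  have hrowv : ∀ j, X v j = 0 := by
    refine eq_zero_of_reachable (A := Aᵀ) (b := a) (r := r) (fun i j => hA.nonneg j i) hcol ?_
      (hXr v) fun l hl => ?_
    · exact (Relation.reflTransGen_swap).2 (hA.reachable a ha)
    · by_cases hlv : l = v
      · subst hlv
        simp [hAv', hdiag]
      · have := hcomm v l (Ne.symm hlv) (fun h => hlv h.2) (hMv l hlv hl)
        rw [Matrix.sub_apply, hmulv, hmul', hMv l hlv hl, hsub a l hav] at this
        simp only [Matrix.transpose_apply, mul_comm (A _ l)]
        linarith
  ext i j
  by_cases hi : i = v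
  · rw [hi, hrowv, Matrix.zero_apply]
  · rw [hsub i j hi, Matrix.zero_apply]

lemma exists_pos_sum_lt (A : Matrix V V ℝ) :
    ∃ γ : ℝ, 0 < γ ∧ (∀ i, ∑ j, A i j < γ) ∧ ∀ j, ∑ i, A i j < γ := by
  obtain ⟨c, hc⟩ := (Set.finite_range fun i => ∑ j, A i j).bddAbove
  obtain ⟨d, hd⟩ := (Set.finite_range fun j => ∑ i, A i j).bddAbove
  refine ⟨|c| + |d| + 1, by positivity, fun i => ?_, fun j => ?_⟩
  · have := hc ⟨i, rfl⟩
    dsimp only at this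
    linarith [le_abs_self c, abs_nonneg d]
  · have := hd ⟨j, rfl⟩
    dsimp only at this
    linarith [le_abs_self d, abs_nonneg c]

/-- The part common to attaching a pendant vertex and attaching an ear with one new vertex. -/
lemma IsCommutatorWitness.of_attach (hA : IsCommutatorWitness r S A) {A' : Matrix V V ℝ}
    (ha : a ∈ S) (hnn : ∀ i j, 0 ≤ A' i j) (hle : ∀ i j, A i j ≠ 0 → A' i j ≠ 0)
    (hav : A' v a ≠ 0)
    (hmem : ∀ i j, A' i j ≠ 0 → i ∈ insert v S ∧ j ∈ insert v S)
    (h0 : ∀ X : Matrix V V ℝ,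
      (∀ i j, X i j ≠ 0 → i ∈ insert v S ∧ j ∈ insert v S ∧ i ≠ j ∧ i ≠ r ∧ j ≠ r) →
      (∀ k l, k ≠ l → A' k l = 0 → (A' * X - X * A') k l = 0) → X = 0) :
    IsCommutatorWitness r (insert v S) A' where
  root_mem := Or.inr hA.root_mem
  nonneg := hnn
  mem_of_ne_zero := hmem
  reachable u hu := by
    have hmono : ∀ u ∈ S, Relation.ReflTransGen (fun x y => A' y x ≠ 0) r u := fun u hu =>
      Relation.ReflTransGen.mono (fun x y => hle y x) _ _ (hA.reachable u hu)
    rcases hu with rfl | hu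
    · exact (hmono a ha).tail hav
    · exact hmono u hu
  eq_zero := h0

lemma IsCommutatorWitness.exists_pendant (hA : IsCommutatorWitness r S A)
    (ha : a ∈ S) (hv : v ∉ S) :
    ∃ A', IsCommutatorWitness r (insert v S) A' ∧
      ∀ i j, A' i j ≠ 0 ↔ A i j ≠ 0 ∨ (i = v ∧ j = v) ∨ (i = v ∧ j = a) := by
  obtain ⟨γ, hγ, hrow, hcol⟩ := exists_pos_sum_lt A
  have hiff := attachVertex_ne_zero_iff hA ha hv hγ
  refine ⟨attachVertex A a v γ, hA.of_attach ha (fun i j => ?_) (fun i j h => (hiff i j).2 (.inl h))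
    ((hiff v a).2 (.inr (.inr ⟨rfl, rfl⟩))) (fun i j h => ?_) (fun X hX hcomm => ?_), hiff⟩
  · unfold attachVertex
    split_ifs
    exacts [hγ.le, zero_le_one, le_rfl, hA.nonneg i j]
  · rcases (hiff i j).1 h with h | ⟨rfl, rfl⟩ | ⟨rfl, rfl⟩
    · exact ⟨.inr (hA.mem_of_ne_zero i j h).1, .inr (hA.mem_of_ne_zero i j h).2⟩
    · exact ⟨.inl rfl, .inl rfl⟩
    · exact ⟨.inl rfl, .inr ha⟩
  · exact hA.attachVertex_eq_zero ha hv .refl hrow hcol hX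
      fun k l hkl _ => hcomm k l hkl

lemma IsCommutatorWitness.exists_ear (hA : IsCommutatorWitness r S A)
    (ha : a ∈ S) (hv : v ∉ S) (hb : b ∈ S)
    (hbr : Relation.ReflTransGen (fun x y => A y x ≠ 0) b r) :
    ∃ A', IsCommutatorWitness r (insert v S) A' ∧
      ∀ i j, A' i j ≠ 0 ↔
        A i j ≠ 0 ∨ (i = v ∧ j = v) ∨ (i = v ∧ j = a) ∨ (i = b ∧ j = v) := by
  obtain ⟨γ, hγ, hrow, hcol⟩ := exists_pos_sum_lt A
  have hiff := attachVertex_ne_zero_iff hA ha hv hγ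
  set M := attachVertex A a v γ with hMdef
  have hM0 : ∀ i j, 0 ≤ M i j := fun i j => by
    rw [hMdef]
    unfold attachVertex
    split_ifs
    exacts [hγ.le, zero_le_one, le_rfl, hA.nonneg i j]
  let adm : V → V → Prop := fun i j =>
    i ∈ insert v S ∧ j ∈ insert v S ∧ i ≠ j ∧ i ≠ r ∧ j ≠ r
  let eqn : V → V → Prop := fun k l => k ≠ l ∧ ¬ (k = b ∧ l = v) ∧ M k l = 0
  let f : Matrix V V ℝ →ₗ[ℝ] (V → V → ℝ) × (V → V → ℝ) :=
    { toFun := fun X => (fun i j => if adm i j then 0 else X i j,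
        fun k l => if eqn k l then (M * X - X * M) k l else 0)
      map_add' := fun X Y => by
        ext k l
        · dsimp; split_ifs <;> simp
        · dsimp; split_ifs
          · simp [mul_add, add_mul]; ring
          · simp
      map_smul' := fun c X => by
        ext k l
        · dsimp; split_ifs <;> simp
        · dsimp; split_ifs
          · simp; ring
          · simp }
  let N : Matrix V V ℝ := Matrix.single b v 1
  let g : Matrix V V ℝ →ₗ[ℝ] (V → V → ℝ) × (V → V → ℝ) :=
    { toFun := fun X => (0, fun k l => if eqn k l then (N * X - X * N) k l else 0)
      map_add' := fun X Y => by
        ext k l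
        · simp
        · dsimp; split_ifs
          · simp [mul_add, add_mul]; ring
          · simp
      map_smul' := fun c X => by
        ext k l
        · simp
        · dsimp; split_ifs
          · simp; ring
          · simp }
  have hf : Function.Injective f := by
    rw [← LinearMap.ker_eq_bot, LinearMap.ker_eq_bot']
    intro X hX
    refine hA.attachVertex_eq_zero ha hv hbr hrow hcol (fun i j hij => ?_)
      (fun k l hkl hkl' h0 => ?_)
    · by_contra hadm
      have := congrFun (congrFun (congrArg Prod.fst hX) i) j
      exact hij ((if_neg (show ¬ adm i j from hadm)).symm.trans this)
    · have := congrFun (congrFun (congrArg Prod.snd hX) k) l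
      exact (if_pos (show eqn k l from ⟨hkl, hkl', h0⟩)).symm.trans this
  obtain ⟨t, ht, hinj⟩ := LinearMap.exists_pos_injective_add_smul f g hf
  have hN : ∀ i j, (M + t • N) i j = M i j + if i = b ∧ j = v then t else 0 := fun i j => by
    simp [N, Matrix.single_apply, eq_comm]
  have hiff' : ∀ i j, (M + t • N) i j ≠ 0 ↔ M i j ≠ 0 ∨ (i = b ∧ j = v) := fun i j => by
    rw [hN]
    split_ifs with h
    · simp only [h, and_self, or_true, iff_true]
      have := hM0 b v
      positivity
    · simp [h]
  have hiff'' : ∀ i j, (M + t • N) i j ≠ 0 ↔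
      A i j ≠ 0 ∨ (i = v ∧ j = v) ∨ (i = v ∧ j = a) ∨ (i = b ∧ j = v) := fun i j => by
    rw [hiff', hiff]
    tauto
  refine ⟨M + t • N, hA.of_attach ha (fun i j => ?_) (fun i j h => (hiff'' i j).2 (.inl h))
    ((hiff'' v a).2 (.inr (.inr (.inl ⟨rfl, rfl⟩)))) (fun i j h => ?_) (fun X hX hcomm => ?_),
    hiff''⟩
  · rw [hN]
    have := hM0 i j
    split_ifs <;> positivity
  · rcases (hiff'' i j).1 h with h | ⟨rfl, rfl⟩ | ⟨rfl, rfl⟩ | ⟨rfl, rfl⟩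
    · exact ⟨.inr (hA.mem_of_ne_zero i j h).1, .inr (hA.mem_of_ne_zero i j h).2⟩
    · exact ⟨.inl rfl, .inl rfl⟩
    · exact ⟨.inl rfl, .inr ha⟩
    · exact ⟨.inr hb, .inl rfl⟩
  · refine hinj (a₁ := X) (a₂ := 0) ?_
    rw [map_zero]
    refine Prod.ext (funext₂ fun i j => ?_) (funext₂ fun k l => ?_)
    · have : (if adm i j then (0 : ℝ) else X i j) = 0 := by
        split_ifs with h
        · rfl
        · by_contra h'
          exact h (hX i j h')
      simpa [f, g] using this
    · have : (if eqn k l then (M * X - X * M) k l else 0) +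
          t * (if eqn k l then (N * X - X * N) k l else 0) = 0 := by
        split_ifs with h
        · have h0 : (M + t • N) k l = 0 := by
            by_contra h'
            exact ((hiff' k l).1 h').elim (fun h1 => h1 h.2.2) h.2.1
          rw [← hcomm k l h.1 h0]
          simp [add_mul, mul_add]
          ring
        · simp
      exact this

end Witness

section Growth

/-- In a strongly connected digraph the distance to a nonempty set drops along some edge out of
each vertex outside the set. -/
lemma exists_descending_level {E : V → V → Prop} (hsc : ∀ u w, Relation.ReflTransGen E u w)
    {T : Set V} {r : V} (hr : r ∈ T) :
    ∃ lev : V → ℕ, ∀ u, u ∉ T → 0 < lev u ∧ ∃ w, E u w ∧ (w ∈ T ∨ lev w < lev u) := by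
  let D : ℕ → V → Prop := fun n =>
    Nat.rec (motive := fun _ => V → Prop) (· ∈ T) (fun _ P u => ∃ w, E u w ∧ P w) n
  have hD : ∀ u, ∃ n, D n u := fun u =>
    Relation.ReflTransGen.head_induction_on (motive := fun u _ => ∃ n, D n u) (hsc u r)
      ⟨0, hr⟩ fun {u w} huw _ ⟨n, hn⟩ => ⟨n + 1, w, huw, hn⟩
  refine ⟨fun u : V => Nat.find (hD u), fun u hu => ?_⟩
  have h0 : Nat.find (hD u) ≠ 0 := fun h => hu (by
    have := Nat.find_spec (hD u)
    rwa [h] at this)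
  obtain ⟨m, hm⟩ := Nat.exists_eq_succ_of_ne_zero h0
  have hspec : D (m + 1) u := by
    have := Nat.find_spec (hD u)
    rwa [hm] at this
  obtain ⟨w, huw, hw⟩ := hspec
  refine ⟨Nat.pos_of_ne_zero h0, w, huw, .inr ?_⟩
  exact (Nat.lt_succ_of_le (Nat.find_min' (hD w) hw)).trans_eq hm.symm

variable [Fintype V] {E : V → V → Prop} {r : V}

/-- A witness on `S`, consisting of `T` and a pendant path with tip `a`, extends along an edge
`a → v` out of `S` until the pendant path closes up to an ear of `T`. -/
lemma IsCommutatorWitness.exists_closed_ear {T : Set V} {lev : V → ℕ}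
    (hlev : ∀ u, u ∉ T → 0 < lev u ∧ ∃ w, E u w ∧ (w ∈ T ∨ lev w < lev u))
    {S : Set V} {A : Matrix V V ℝ} {a v : V} (hA : IsCommutatorWitness r S A)
    (hE : ∀ i j, i ≠ j → A i j ≠ 0 → E j i) (hTS : T ⊆ S)
    (hT : ∀ u ∈ T, Relation.ReflTransGen (fun x y => A y x ≠ 0) u r)
    (hS : ∀ u ∈ S, Relation.ReflTransGen (fun x y => A y x ≠ 0) u a)
    (ha : a ∈ S) (hav : E a v) (hv : v ∉ T) (hSv : ∀ u ∈ S, u ∉ T → lev v < lev u) :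
    ∃ S' A', T ⊂ S' ∧ IsCommutatorWitness r S' A' ∧ (∀ i j, i ≠ j → A' i j ≠ 0 → E j i) ∧
      ∀ u ∈ S', Relation.ReflTransGen (fun x y => A' y x ≠ 0) u r := by
  induction hN : lev v using Nat.strong_induction_on generalizing S A a v with
  | _ N ih =>
    have hvS : v ∉ S := fun h => (hSv v h hv).false
    obtain ⟨-, w, hvw, hw⟩ := hlev v hv
    by_cases hwT : w ∈ T
    · obtain ⟨A', hA', hiff⟩ := hA.exists_ear ha hvS (hTS hwT) (hT w hwT)
      have hmono : ∀ {x y}, Relation.ReflTransGen (fun x y => A y x ≠ 0) x y →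
          Relation.ReflTransGen (fun x y => A' y x ≠ 0) x y := fun h =>
        Relation.ReflTransGen.mono (fun x y hxy => (hiff y x).2 (.inl hxy)) _ _ h
      have hvr : Relation.ReflTransGen (fun x y => A' y x ≠ 0) v r :=
        .head ((hiff w v).2 (.inr (.inr (.inr ⟨rfl, rfl⟩)))) (hmono (hT w hwT))
      refine ⟨insert v S, A', ⟨hTS.trans (Set.subset_insert v S), fun h => hv (h (.inl rfl))⟩,
        hA', fun i j hij h => ?_, fun u hu => ?_⟩
      · rcases (hiff i j).1 h with h | ⟨rfl, rfl⟩ | ⟨rfl, rfl⟩ | ⟨rfl, rfl⟩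
        exacts [hE i j hij h, absurd rfl hij, hav, hvw]
      · rcases hu with rfl | hu
        · exact hvr
        · exact (hmono (hS u hu)).trans
            (.head ((hiff v a).2 (.inr (.inr (.inl ⟨rfl, rfl⟩)))) hvr)
    · have hlt := hw.resolve_left hwT
      obtain ⟨A', hA', hiff⟩ := hA.exists_pendant ha hvS
      have hmono : ∀ {x y}, Relation.ReflTransGen (fun x y => A y x ≠ 0) x y →
          Relation.ReflTransGen (fun x y => A' y x ≠ 0) x y := fun h =>
        Relation.ReflTransGen.mono (fun x y hxy => (hiff y x).2 (.inl hxy)) _ _ h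
      refine ih (lev w) (hN ▸ hlt) hA' (fun i j hij h => ?_) (hTS.trans (Set.subset_insert v S))
        (fun u hu => hmono (hT u hu)) (fun u hu => ?_) (.inl rfl) hvw hwT (fun u hu huT => ?_) rfl
      · rcases (hiff i j).1 h with h | ⟨rfl, rfl⟩ | ⟨rfl, rfl⟩
        exacts [hE i j hij h, absurd rfl hij, hav]
      · rcases hu with rfl | hu
        · exact .refl
        · exact (hmono (hS u hu)).tail ((hiff v a).2 (.inr (.inr ⟨rfl, rfl⟩)))
      · rcases hu with rfl | hu
        · exact hlt
        · exact hlt.trans (hSv u hu huT)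

/-- A strongly connected digraph has a spanning strongly connected subdigraph, built from ears
with at least one new vertex each, that carries a commutator witness. -/
lemma exists_spanning_commutatorWitness (hsc : ∀ u w, Relation.ReflTransGen E u w) (r : V) :
    ∃ A : Matrix V V ℝ, IsCommutatorWitness r Set.univ A ∧
      (∀ i j, i ≠ j → A i j ≠ 0 → E j i) ∧
      ∀ u, Relation.ReflTransGen (fun x y => A y x ≠ 0) u r := by
  obtain ⟨T, ⟨A, hA, hE, hT⟩, hmax⟩ := (Set.toFinite {S : Set V | ∃ A : Matrix V V ℝ,
    IsCommutatorWitness r S A ∧ (∀ i j, i ≠ j → A i j ≠ 0 → E j i) ∧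
      ∀ u ∈ S, Relation.ReflTransGen (fun x y => A y x ≠ 0) u r}).exists_maximal
    ⟨{r}, _, .singleton r, fun i j hij h => by
      simp only [Matrix.single_apply, ne_eq, ite_eq_right_iff, not_forall] at h
      obtain ⟨⟨rfl, rfl⟩, -⟩ := h
      exact absurd rfl hij, fun u hu => by rw [Set.mem_singleton_iff.1 hu]⟩
  suffices hT' : T = Set.univ by
    subst hT'
    exact ⟨A, hA, hE, fun u => hT u trivial⟩
  by_contra hne
  obtain ⟨x, hx⟩ := (Set.ne_univ_iff_exists_notMem T).1 hne
  obtain ⟨u, hu, v, hv, huv⟩ : ∃ u ∈ T, ∃ v, v ∉ T ∧ E u v := by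
    by_contra! hclosed
    refine hx (Relation.ReflTransGen.head_induction_on
      (motive := fun u _ => u ∈ T → x ∈ T) (hsc r x) id (fun {u w} huw _ ih hu => ih ?_)
      hA.root_mem)
    by_contra hw
    exact hclosed u hu w hw huw
  obtain ⟨lev, hlev⟩ := exists_descending_level hsc hA.root_mem
  obtain ⟨S', A', hTS, hA', hE', hS'⟩ := hA.exists_closed_ear hlev hE subset_rfl hT
    (fun w hw => (hT w hw).trans (hA.reachable u hu)) hu huv hv
    (fun w hw hwT => absurd hw hwT)
  exact hTS.not_subset (hmax ⟨A', hA', hE', hS'⟩ hTS.subset)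

end Growth

section CoefficientMatrix

variable [Fintype V] {E : V → V → Prop} {r : V}

/-- A vector indexed by the columns of `Bmat E r A`, extended by zero to a matrix. -/
noncomputable def columnMatrix {r : V}
    (x : {p : V × V // p.1 ≠ p.2 ∧ p.1 ≠ r ∧ p.2 ≠ r} → ℂ) : Matrix V V ℂ :=
  fun i j => if h : i ≠ j ∧ i ≠ r ∧ j ≠ r then x ⟨(i, j), h⟩ else 0

lemma Bmat_mulVec (A : Matrix V V ℂ)
    (x : {p : V × V // p.1 ≠ p.2 ∧ p.1 ≠ r ∧ p.2 ≠ r} → ℂ)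
    (kl : {p : V × V // p.1 ≠ p.2 ∧ ¬ E p.2 p.1}) :
    (Bmat E r A *ᵥ x) kl =
      (A * columnMatrix x - columnMatrix x * A) kl.1.1 kl.1.2 := by
  obtain ⟨⟨k, l⟩, hkl⟩ := kl
  let c : V × V → ℂ := fun p =>
    (if p.2 = l then A k p.1 else 0) - (if p.1 = k then A p.2 l else 0)
  have hB : ∀ ij, Bmat E r A ⟨(k, l), hkl⟩ ij = c ij.1 := by
    rintro ⟨⟨i, j⟩, hij⟩
    simp only [Bmat, c]
    by_cases hi : i = k <;> by_cases hj : j = l <;> simp [hi, hj]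
  have hsum : (Bmat E r A *ᵥ x) ⟨(k, l), hkl⟩ = ∑ p : V × V, c p * columnMatrix x p.1 p.2 := by
    rw [Matrix.mulVec, dotProduct,
      ← Finset.sum_subset (Finset.subset_univ {p : V × V | p.1 ≠ p.2 ∧ p.1 ≠ r ∧ p.2 ≠ r})
        fun p _ hp => by rw [columnMatrix, dif_neg (by simpa using hp), mul_zero],
      Finset.sum_subtype (p := fun p : V × V => p.1 ≠ p.2 ∧ p.1 ≠ r ∧ p.2 ≠ r) _ (by simp)]
    refine Finset.sum_congr rfl fun ij _ => ?_
    rw [hB, columnMatrix, dif_pos ij.2]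
  rw [hsum, Fintype.sum_prod_type]
  simp [c, sub_mul, Matrix.mul_apply, Finset.sum_sub_distrib, ite_mul]
  exact Finset.sum_congr rfl fun j _ => mul_comm _ _

/-- A commutator witness on all of `V` whose off-diagonal zeros are exactly the non-edges gives a
coefficient matrix of full column rank. -/
lemma IsCommutatorWitness.rank_Bmat {A : Matrix V V ℝ}
    (hA : IsCommutatorWitness r Set.univ A) (hE : ∀ k l, k ≠ l → A k l = 0 → ¬ E l k) :
    (Bmat E r (A.map Complex.ofReal)).rank =
      Fintype.card {p : V × V // p.1 ≠ p.2 ∧ p.1 ≠ r ∧ p.2 ≠ r} := by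
  have hinj : Function.Injective (Bmat E r (A.map Complex.ofReal)).mulVecLin := by
    rw [← LinearMap.ker_eq_bot, LinearMap.ker_eq_bot']
    intro x hx
    have hsupp : ∀ i j, columnMatrix x i j ≠ 0 → i ≠ j ∧ i ≠ r ∧ j ≠ r := fun i j h => by
      by_contra h'
      exact h (dif_neg h')
    have hcomm : ∀ k l, k ≠ l → A k l = 0 →
        (A.map Complex.ofReal * columnMatrix x - columnMatrix x * A.map Complex.ofReal) k l = 0 :=
      fun k l hkl h => by
        rw [← Bmat_mulVec _ x ⟨(k, l), hkl, hE k l hkl h⟩]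
        exact congrFun hx _
    have hre := hA.eq_zero ((columnMatrix x).map Complex.re)
      (fun i j h => ⟨trivial, trivial, hsupp i j fun h0 => h (by simp [h0])⟩)
      (fun k l hkl h => by
        have := congrArg Complex.re (hcomm k l hkl h)
        simpa [Matrix.mul_apply] using this)
    have him := hA.eq_zero ((columnMatrix x).map Complex.im)
      (fun i j h => ⟨trivial, trivial, hsupp i j fun h0 => h (by simp [h0])⟩)
      (fun k l hkl h => by
        have := congrArg Complex.im (hcomm k l hkl h)
        simpa [Matrix.mul_apply] using this)
    ext ⟨⟨i, j⟩, hij⟩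
    have hx' : columnMatrix x i j = x ⟨(i, j), hij⟩ := dif_pos hij
    rw [← hx']
    exact Complex.ext (congrFun (congrFun hre i) j) (congrFun (congrFun him i) j)
  rw [Matrix.rank, LinearMap.finrank_range_of_inj hinj, Module.finrank_fintype_fun_eq_card]

lemma card_offDiag_ne (r : V) :
    Fintype.card {p : V × V // p.1 ≠ p.2 ∧ p.1 ≠ r ∧ p.2 ≠ r} =
      (Fintype.card V - 1) * (Fintype.card V - 2) := by
  rw [Fintype.card_of_subtype (Finset.univ.erase r).offDiag fun p => by
      simp only [Finset.mem_offDiag, Finset.mem_erase, Finset.mem_univ, and_true]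
      tauto,
    Finset.offDiag_card, Finset.card_erase_of_mem (Finset.mem_univ r), Finset.card_univ,
    ← Nat.mul_sub_one, Nat.sub_sub]

end CoefficientMatrix


/-- If `G` is a minimally strongly connected directed simple
graph on `Fin n` (`n ≥ 2`) with distinguished vertex `0` — removing any single
edge destroys strong connectedness — then there exists `A ∈ Θ_G` such that
`B_G(A)` has full column rank `(n-1)(n-2)`. -/
theorem minimallyStronglyConnected_fullB (n : ℕ) (hn : 2 ≤ n)
    (E : Fin n → Fin n → Prop) (hirr : ∀ u, ¬ E u u)
    (hsc : ∀ u w : Fin n, Relation.ReflTransGen E u w)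
    (hmin : ∀ a b, E a b →
      ¬ (∀ u w : Fin n, Relation.ReflTransGen
          (fun x y => E x y ∧ ¬(x = a ∧ y = b)) u w)) :
    ∃ A ∈ Theta E,
      (Bmat E (⟨0, by omega⟩ : Fin n) A).rank = (n - 1) * (n - 2) := by
  obtain ⟨A, hA, hAE, hr⟩ := exists_spanning_commutatorWitness hsc (⟨0, by omega⟩ : Fin n)
  have hEA : ∀ k l, k ≠ l → A k l = 0 → ¬ E l k := fun k l _ h0 hE => by
    refine hmin l k hE fun u w => ?_
    have huw := (hr u).trans (hA.reachable w trivial)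
    induction huw with
    | refl => exact .refl
    | @tail x y _ hxy ih =>
      by_cases hyx : y = x
      · exact hyx ▸ ih
      · refine ih.tail ⟨hAE y x hyx hxy, ?_⟩
        rintro ⟨rfl, rfl⟩
        exact hxy h0
  refine ⟨A.map Complex.ofReal, fun i j hij hE => ?_, ?_⟩
  · have : A i j = 0 := by
      by_contra h
      exact hE (hAE i j hij h)
    simp [this]
  · have hcard := card_offDiag_ne (⟨0, by omega⟩ : Fin n)
    rw [Fintype.card_fin] at hcard
    rw [← hcard]
    convert hA.rank_Bmat hEA
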